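/- Write x_{ij} = x_i − x_j, fix r ∈ ℝ with r ≠ 0, and let U = {x ∈ ℝ⁴ : the coordinates x₁,x₂,x₃,x₄ are pairwise distinct}. Let ρ(x) = x₁₂/(x₁₄²x₂₄²x₃₄). Then for every λ ∈ ℝ the vector fields X₁(λ) = −((x₁₄x₃₄ − r(x₁₄x₂₄ + x₁₄x₃₄ + x₂₄x₃₄))/(r·x₁₂x₃₄))(λ−x₁)∂₁ + ((x₂₄x₃₄ − r(x₁₄x₂₄ + x₁₄x₃₄ + x₂₄x₃₄))/(r·x₁₂x₃₄))(λ−x₂)∂₂ − (λ−x₄)∂₄ and X₂(λ) = −(x₂₃x₁₄/(x₁₂x₃₄))(λ−x₁)∂₁ + (x₁₃x₂₄/(x₁₂x₃₄))(λ−x₂)∂₂ − (λ−x₃)∂₃ are divergence free with respect to the volume form ω = ρ dx₁∧dx₂∧dx₃∧dx₄, i.e. ∑_{j=1}^4 ∂_j(ρ · X_a(λ)^j) = 0 on U for a = 1,2. -/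

import Mathlib

open scoped BigOperators

/-- Partial derivative `∂f/∂x_j` on ℝ⁴ (coordinates `x₁,…,x₄` are indexed by `Fin 4`,
so `x_i` corresponds to index `i-1`). -/
noncomputable def pd (f : (Fin 4 → ℝ) → ℝ) (j : Fin 4) (x : Fin 4 → ℝ) : ℝ :=
  fderiv ℝ f x (Pi.single j 1)

/-- The first vector field `X₁(λ)` of Example 2 (case A₀, parameter `r`);
`x_{ij} = x_i − x_j` with 1-based indices mapped to `Fin 4`. -/
noncomputable def X1 (r lam : ℝ) (y : Fin 4 → ℝ) : Fin 4 → ℝ :=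
  ![-(((y 0 - y 3) * (y 2 - y 3)
        - r * ((y 0 - y 3) * (y 1 - y 3) + (y 0 - y 3) * (y 2 - y 3)
              + (y 1 - y 3) * (y 2 - y 3)))
      / (r * (y 0 - y 1) * (y 2 - y 3))) * (lam - y 0),
    (((y 1 - y 3) * (y 2 - y 3)
        - r * ((y 0 - y 3) * (y 1 - y 3) + (y 0 - y 3) * (y 2 - y 3)
              + (y 1 - y 3) * (y 2 - y 3)))
      / (r * (y 0 - y 1) * (y 2 - y 3))) * (lam - y 1),
    0,
    -(lam - y 3)]

/-- The second vector field `X₂(λ)` of Example 2 (case A₀). -/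
noncomputable def X2 (lam : ℝ) (y : Fin 4 → ℝ) : Fin 4 → ℝ :=
  ![-((y 1 - y 2) * (y 0 - y 3) / ((y 0 - y 1) * (y 2 - y 3))) * (lam - y 0),
    ((y 0 - y 2) * (y 1 - y 3) / ((y 0 - y 1) * (y 2 - y 3))) * (lam - y 1),
    -(lam - y 2),
    0]

/-- `ρ(x) = x₁₂/(x₁₄²x₂₄²x₃₄)`. -/
noncomputable def ρ (x : Fin 4 → ℝ) : ℝ :=
  (x 0 - x 1) / ((x 0 - x 3) ^ 2 * (x 1 - x 3) ^ 2 * (x 2 - x 3))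

section PartialDerivative

variable {f g : (Fin 4 → ℝ) → ℝ} {x : Fin 4 → ℝ}

theorem pd_const (c : ℝ) (j : Fin 4) : pd (fun _ => c) j x = 0 := by
  simp [pd]

theorem pd_coord (i j : Fin 4) : pd (fun y => y i) j x = if i = j then 1 else 0 := by
  have h : HasFDerivAt (fun y : Fin 4 → ℝ => y i)
      (ContinuousLinearMap.proj (R := ℝ) (φ := fun _ : Fin 4 => ℝ) i) x := hasFDerivAt_apply i x
  rw [pd, h.fderiv, ContinuousLinearMap.proj_apply, Pi.single_apply]

theorem pd_neg (j : Fin 4) : pd (fun y => -f y) j x = -pd f j x := by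
  simp [pd, fderiv_fun_neg]

theorem pd_add (hf : DifferentiableAt ℝ f x) (hg : DifferentiableAt ℝ g x) (j : Fin 4) :
    pd (fun y => f y + g y) j x = pd f j x + pd g j x := by
  simp [pd, fderiv_fun_add hf hg]

theorem pd_sub (hf : DifferentiableAt ℝ f x) (hg : DifferentiableAt ℝ g x) (j : Fin 4) :
    pd (fun y => f y - g y) j x = pd f j x - pd g j x := by
  simp [pd, fderiv_fun_sub hf hg]

theorem pd_mul (hf : DifferentiableAt ℝ f x) (hg : DifferentiableAt ℝ g x) (j : Fin 4) :
    pd (fun y => f y * g y) j x = pd f j x * g x + f x * pd g j x := by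
  simp [pd, fderiv_fun_mul hf hg]
  ring

theorem pd_div (hf : DifferentiableAt ℝ f x) (hg : DifferentiableAt ℝ g x) (hx : g x ≠ 0)
    (j : Fin 4) :
    pd (fun y => f y / g y) j x = (pd f j x * g x - f x * pd g j x) / g x ^ 2 := by
  have hd : DifferentiableAt ℝ (fun y => f y / g y) x := by fun_prop (disch := exact hx)
  have hev : f =ᶠ[nhds x] fun y => f y / g y * g y := by
    filter_upwards [hg.continuousAt.eventually_ne hx] with y hy
    exact (div_mul_cancel₀ _ hy).symm
  have h : pd f j x = pd (fun y => f y / g y * g y) j x := by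
    rw [pd, pd, hev.fderiv_eq]
  rw [pd_mul hd hg] at h
  rw [h]
  field_simp
  ring

end PartialDerivative

/-- For `r ≠ 0`, on `U = {x : coordinates pairwise distinct}`, for every
`λ ∈ ℝ` the vector fields `X₁(λ), X₂(λ)` are divergence free with respect to the
volume form `ω = ρ dx₁∧dx₂∧dx₃∧dx₄`: `∑_j ∂_j(ρ·X_a(λ)^j) = 0` for `a = 1,2`. -/
theorem example2_vector_fields_divergence_free (r : ℝ) (hr : r ≠ 0) :
    ∀ lam : ℝ, ∀ x : Fin 4 → ℝ,
      (∀ i j : Fin 4, i ≠ j → x i ≠ x j) →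
      (∑ j, pd (fun y => ρ y * X1 r lam y j) j x = 0) ∧
      (∑ j, pd (fun y => ρ y * X2 lam y j) j x = 0) := by
  intro lam x hx
  have h01 : x 0 - x 1 ≠ 0 := sub_ne_zero.mpr (hx 0 1 (by decide))
  have h03 : x 0 - x 3 ≠ 0 := sub_ne_zero.mpr (hx 0 3 (by decide))
  have h13 : x 1 - x 3 ≠ 0 := sub_ne_zero.mpr (hx 1 3 (by decide))
  have h23 : x 2 - x 3 ≠ 0 := sub_ne_zero.mpr (hx 2 3 (by decide))
  have hρ : (x 0 - x 3) * (x 0 - x 3) * ((x 1 - x 3) * (x 1 - x 3)) * (x 2 - x 3) ≠ 0 := by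
    positivity
  have h1 : r * (x 0 - x 1) * (x 2 - x 3) ≠ 0 := by positivity
  have h2 : (x 0 - x 1) * (x 2 - x 3) ≠ 0 := by positivity
  constructor
  · simp only [Fin.sum_univ_four, X1, ρ, Matrix.cons_val, pow_two]
    simp (disch := first | assumption | fun_prop (disch := assumption)) only
      [pd_const, pd_coord, pd_neg, pd_add, pd_sub, pd_mul, pd_div, mul_zero]
    simp only [Fin.reduceEq, if_true, if_false]
    field_simp
    ring
  · simp only [Fin.sum_univ_four, X2, ρ, Matrix.cons_val, pow_two]
    simp (disch := first | assumption | fun_prop (disch := assumption)) only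
      [pd_const, pd_coord, pd_neg, pd_sub, pd_mul, pd_div, mul_zero]
    simp only [Fin.reduceEq, if_true, if_false]
    field_simp
    ring
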